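/- Let μ = (1/2) δ_{−1} + (1/2) δ_1. Then the uniform distribution Unif(−3/2, 3/2) on the interval [−3/2, 3/2] is the unique minimizer of ν ↦ W_2(ν, μ) over ν ∈ F_lc; that is, proj_{F_lc} μ = Unif(−3/2, 3/2). -/

import Mathlib

open MeasureTheory Set Filter

noncomputable def quantile (μ : MeasureTheory.Measure ℝ) (u : ℝ) : ℝ :=
  sInf {x : ℝ | u ≤ (μ (Set.Iic x)).toReal}

def HasFiniteMomentP (p : ℝ) (μ : MeasureTheory.Measure ℝ) : Prop :=
  MeasureTheory.IsProbabilityMeasure μ ∧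
    MeasureTheory.Integrable (fun x => |x| ^ p) μ

noncomputable def Wdist (p : ℝ) (μ ν : MeasureTheory.Measure ℝ) : ℝ :=
  (∫ u in Set.Ioo (0:ℝ) 1, |quantile μ u - quantile ν u| ^ p) ^ (1 / p)

def DisplacementConvex (F : Set (MeasureTheory.Measure ℝ)) : Prop :=
  ∀ μ ∈ F, ∀ ν ∈ F, ∀ t ∈ Set.Icc (0:ℝ) 1, ∃ σ ∈ F,
    ∀ u ∈ Set.Ioo (0:ℝ) 1,
      quantile σ u = (1 - t) * quantile μ u + t * quantile ν u

def WClosed (p : ℝ) (F : Set (MeasureTheory.Measure ℝ)) : Prop :=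
  ∀ (μs : ℕ → MeasureTheory.Measure ℝ) (μ : MeasureTheory.Measure ℝ),
    (∀ n, μs n ∈ F) → HasFiniteMomentP p μ →
    Filter.Tendsto (fun n => Wdist p (μs n) μ) Filter.atTop (nhds 0) → μ ∈ F

/-- A Borel probability measure on `ℝ` is log-concave if it is a point mass, or it has a
density `f` with respect to Lebesgue measure such that `log f : ℝ → [−∞, ∞)` is concave;
the latter is expressed by the multiplicative inequality
`f((1−t)x + ty) ≥ f(x)^(1−t) · f(y)^t`. -/
def IsLogConcave (μ : MeasureTheory.Measure ℝ) : Prop :=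
  (∃ x : ℝ, μ = MeasureTheory.Measure.dirac x) ∨
  ∃ f : ℝ → ℝ, (∀ x, 0 ≤ f x) ∧
    μ = MeasureTheory.volume.withDensity (fun x => ENNReal.ofReal (f x)) ∧
    ∀ x y : ℝ, ∀ t ∈ Set.Icc (0:ℝ) 1,
      f x ^ (1 - t) * f y ^ t ≤ f ((1 - t) * x + t * y)

/-- The set `F_lc` of log-concave probability measures on `ℝ`. -/
def Flc : Set (MeasureTheory.Measure ℝ) :=
  {μ | MeasureTheory.IsProbabilityMeasure μ ∧ IsLogConcave μ}

lemma quantile_le_iff {ν : Measure ℝ} [IsProbabilityMeasure ν] {u : ℝ} (hu : u ∈ Ioo (0 : ℝ) 1)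
    (x : ℝ) : quantile ν u ≤ x ↔ u ≤ ν.real (Iic x) := by
  have hmono := (ProbabilityTheory.cdf ν).mono
  have hF : ∀ x, (ν (Iic x)).toReal = ProbabilityTheory.cdf ν x := fun x =>
    (ProbabilityTheory.cdf_eq_real ν x).symm
  have hne : {x : ℝ | u ≤ (ν (Iic x)).toReal}.Nonempty := by
    obtain ⟨y, hy⟩ := ((ProbabilityTheory.tendsto_cdf_atTop ν).eventually
      (lt_mem_nhds hu.2)).exists
    exact ⟨y, by simpa only [mem_ofPred_eq, hF] using hy.le⟩
  have hbdd : BddBelow {x : ℝ | u ≤ (ν (Iic x)).toReal} := by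
    obtain ⟨y, hy⟩ := ((ProbabilityTheory.tendsto_cdf_atBot ν).eventually
      (gt_mem_nhds hu.1)).exists
    refine ⟨y, fun z hz => ?_⟩
    by_contra! hlt
    simp only [mem_ofPred_eq, hF] at hz
    exact absurd (hz.trans (hmono hlt.le)) (not_le.2 hy)
  constructor
  · intro h
    have hright : Tendsto (ProbabilityTheory.cdf ν) (nhdsWithin x (Ioi x))
        (nhds (ProbabilityTheory.cdf ν x)) :=
      ((ProbabilityTheory.cdf ν).right_continuous x).mono_left
        (nhdsWithin_mono _ Ioi_subset_Ici_self)
    rw [Measure.real, hF]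
    refine ge_of_tendsto hright ?_
    filter_upwards [self_mem_nhdsWithin] with y hy
    obtain ⟨z, hz, hzy⟩ := exists_lt_of_csInf_lt hne (lt_of_le_of_lt h hy)
    simp only [mem_ofPred_eq, hF] at hz
    exact hz.trans (hmono hzy.le)
  · intro h
    exact csInf_le hbdd h

lemma quantile_monotoneOn (ν : Measure ℝ) [IsProbabilityMeasure ν] :
    MonotoneOn (quantile ν) (Ioo 0 1) := fun _ hu _ hv huv =>
  (quantile_le_iff hu _).2 (huv.trans ((quantile_le_iff hv _).1 le_rfl))

lemma aemeasurable_quantile (ν : Measure ℝ) [IsProbabilityMeasure ν] :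
    AEMeasurable (quantile ν) (volume.restrict (Ioo 0 1)) :=
  aemeasurable_restrict_of_monotoneOn measurableSet_Ioo (quantile_monotoneOn ν)

lemma map_quantile (ν : Measure ℝ) [IsProbabilityMeasure ν] :
    Measure.map (quantile ν) (volume.restrict (Ioo 0 1)) = ν := by
  have : IsFiniteMeasure (Measure.map (quantile ν) (volume.restrict (Ioo (0 : ℝ) 1))) :=
    Measure.isFiniteMeasure_map _ _
  refine Measure.ext_of_Iic _ _ fun x => ?_
  have h0 : 0 ≤ ν.real (Iic x) := measureReal_nonneg
  have h1 : ν.real (Iic x) ≤ 1 := measureReal_le_one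
  have hset : (quantile ν ⁻¹' Iic x : Set ℝ) ∩ Ioo 0 1 =
      Iic (ν.real (Iic x)) ∩ Ioo 0 1 := by
    ext u
    simp only [mem_inter_iff, mem_preimage, mem_Iic]
    exact and_congr_left fun hu => quantile_le_iff hu x
  have hae : (Iic (ν.real (Iic x)) ∩ Ioo 0 1 : Set ℝ) =ᵐ[volume] Ioc 0 (ν.real (Iic x)) := by
    have : (Iic (ν.real (Iic x)) ∩ Ioc 0 1 : Set ℝ) = Ioc 0 (ν.real (Iic x)) := by
      ext u
      simp only [mem_inter_iff, mem_Iic, mem_Ioc]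
      constructor
      · rintro ⟨h, h', _⟩
        exact ⟨h', h⟩
      · rintro ⟨h, h'⟩
        exact ⟨h', h, h'.trans h1⟩
    rw [← this]
    exact (ae_eq_refl _).inter Ioo_ae_eq_Ioc
  rw [Measure.map_apply_of_aemeasurable (aemeasurable_quantile ν) measurableSet_Iic,
    Measure.restrict_apply' measurableSet_Ioo, hset, measure_congr hae, Real.volume_Ioc, sub_zero,
    ofReal_measureReal]

lemma measureReal_Iic_quantile {ν : Measure ℝ} [IsProbabilityMeasure ν] [NullSingletonClass ν] {u : ℝ}
    (hu : u ∈ Ioo (0 : ℝ) 1) : ν.real (Iic (quantile ν u)) = u := by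
  refine le_antisymm ?_ ((quantile_le_iff hu _).1 le_rfl)
  set q := quantile ν u
  have hlim := (ProbabilityTheory.cdf ν).mono.tendsto_leftLim q
  have hsing := (ProbabilityTheory.cdf ν).measure_singleton q
  rw [ProbabilityTheory.measure_cdf, measure_singleton, eq_comm, ENNReal.ofReal_eq_zero] at hsing
  have : Function.leftLim (ProbabilityTheory.cdf ν) q ≤ u := by
    refine le_of_tendsto hlim ?_
    filter_upwards [self_mem_nhdsWithin] with y hy
    rw [ProbabilityTheory.cdf_eq_real]
    by_contra! hlt
    exact absurd ((quantile_le_iff hu y).2 hlt.le) (not_le.2 hy)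
  rw [← ProbabilityTheory.cdf_eq_real]
  linarith

lemma log_three_point {f : ℝ → ℝ}
    (hf : ∀ x y : ℝ, ∀ t ∈ Icc (0 : ℝ) 1, f x ^ (1 - t) * f y ^ t ≤ f ((1 - t) * x + t * y))
    {a b c : ℝ} (hab : a ≤ b) (hbc : b ≤ c) (hac : a < c) (ha : 0 < f a) (hc : 0 < f c) :
    0 < f b ∧
      (c - b) * Real.log (f a) + (b - a) * Real.log (f c) ≤ (c - a) * Real.log (f b) := by
  have hca : 0 < c - a := sub_pos.2 hac
  have key := hf a c ((b - a) / (c - a))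
    ⟨div_nonneg (by linarith) hca.le, (div_le_one hca).2 (by linarith)⟩
  have hb : (1 - (b - a) / (c - a)) * a + (b - a) / (c - a) * c = b := by
    field_simp
    ring
  rw [hb] at key
  have hpos := mul_pos (Real.rpow_pos_of_pos ha (1 - (b - a) / (c - a)))
    (Real.rpow_pos_of_pos hc ((b - a) / (c - a)))
  refine ⟨hpos.trans_le key, ?_⟩
  have hlog := Real.log_le_log hpos key
  rw [Real.log_mul (Real.rpow_pos_of_pos ha _).ne' (Real.rpow_pos_of_pos hc _).ne',
    Real.log_rpow ha, Real.log_rpow hc] at hlog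
  have h1 : (c - a) * (1 - (b - a) / (c - a)) = c - b := by
    field_simp
    ring
  have h2 : (c - a) * ((b - a) / (c - a)) = b - a := by
    field_simp
  calc _ = (c - a) * ((1 - (b - a) / (c - a)) * Real.log (f a) +
        (b - a) / (c - a) * Real.log (f c)) := by
        rw [mul_add, ← mul_assoc, ← mul_assoc, h1, h2]
    _ ≤ _ := mul_le_mul_of_nonneg_left hlog hca.le

lemma measurable_of_log_concave {f : ℝ → ℝ} (hf0 : ∀ x, 0 ≤ f x)
    (hf : ∀ x y : ℝ, ∀ t ∈ Icc (0 : ℝ) 1, f x ^ (1 - t) * f y ^ t ≤ f ((1 - t) * x + t * y)) :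
    Measurable f := by
  refine measurable_of_Ioi fun r => ?_
  rcases lt_or_ge r 0 with hr | hr
  · have : f ⁻¹' Ioi r = univ := eq_univ_of_forall fun x => hr.trans_le (hf0 x)
    rw [this]
    exact MeasurableSet.univ
  refine OrdConnected.measurableSet ⟨fun a ha c hc b hb => ?_⟩
  simp only [mem_preimage, mem_Ioi] at ha hc ⊢
  rcases hb.1.eq_or_lt with rfl | hab
  · exact ha
  have hac := hab.trans_le hb.2
  obtain ⟨hpos, hlog⟩ := log_three_point hf hb.1 hb.2 hac (hr.trans_lt ha) (hr.trans_lt hc)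
  by_contra! hle
  have h1 := Real.log_lt_log hpos (hle.trans_lt ha)
  have h2 := Real.log_lt_log hpos (hle.trans_lt hc)
  nlinarith [mul_pos (sub_pos.2 hab) (sub_pos.2 h2),
    mul_nonneg (sub_nonneg.2 hb.2) (sub_pos.2 h1).le]

lemma le_exp_of_log_concave {f : ℝ → ℝ} (hf0 : ∀ x, 0 ≤ f x)
    (hf : ∀ x y : ℝ, ∀ t ∈ Icc (0 : ℝ) 1, f x ^ (1 - t) * f y ^ t ≤ f ((1 - t) * x + t * y))
    {c d s : ℝ} (hcd : c < d) (hc : 0 < f c) (hd : 0 < f d)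
    (hs : s * (d - c) = Real.log (f d) - Real.log (f c)) {t : ℝ} (ht : t ≤ c ∨ d ≤ t) :
    f t ≤ f c * Real.exp (s * (t - c)) := by
  rcases (hf0 t).eq_or_lt with h0 | h0
  · rw [← h0]
    positivity
  have hcd' := sub_pos.2 hcd
  rw [← Real.log_le_log_iff h0 (by positivity), Real.log_mul hc.ne' (Real.exp_pos _).ne',
    Real.log_exp]
  refine le_of_mul_le_mul_left ?_ hcd'
  rcases ht with ht | ht
  · have := (log_three_point hf ht hcd.le (ht.trans_lt hcd) h0 hd).2
    linear_combination this - (t - c) * hs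
  · have := (log_three_point hf hcd.le ht (hcd.trans_le ht) hc h0).2
    linear_combination this - (t - c) * hs

lemma exp_le_of_log_concave {f : ℝ → ℝ}
    (hf : ∀ x y : ℝ, ∀ t ∈ Icc (0 : ℝ) 1, f x ^ (1 - t) * f y ^ t ≤ f ((1 - t) * x + t * y))
    {c d s : ℝ} (hcd : c < d) (hc : 0 < f c) (hd : 0 < f d)
    (hs : s * (d - c) = Real.log (f d) - Real.log (f c)) {t : ℝ} (ht : t ∈ Icc c d) :
    f c * Real.exp (s * (t - c)) ≤ f t := by
  have hcd' := sub_pos.2 hcd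
  obtain ⟨h0, h⟩ := log_three_point hf ht.1 ht.2 hcd hc hd
  rw [← Real.log_le_log_iff (by positivity) h0, Real.log_mul hc.ne' (Real.exp_pos _).ne',
    Real.log_exp]
  refine le_of_mul_le_mul_left ?_ hcd'
  linear_combination h + (t - c) * hs

lemma mul_integral_exp (α s c a b : ℝ) :
    s * ∫ t in a..b, α * Real.exp (s * (t - c)) =
      α * Real.exp (s * (b - c)) - α * Real.exp (s * (a - c)) := by
  rw [← intervalIntegral.integral_const_mul]
  refine intervalIntegral.integral_eq_sub_of_hasDerivAt
    (f := fun t => α * Real.exp (s * (t - c))) (fun t _ => ?_)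
    (Continuous.intervalIntegrable (by fun_prop) _ _)
  have := ((((hasDerivAt_id t).sub_const c).const_mul s).exp).const_mul α
  exact this.congr_deriv (by simp only [id]; ring)

lemma inv_add_inv_mul_le {α β s m l₁ l₂ : ℝ} (hα : 0 < α) (hs : 0 < s) (hm : 0 ≤ m)
    (hαβ : α ≤ β) (h₁ : s * m ≤ α - α * Real.exp (-(s * l₁)))
    (h₂ : s * m ≤ β * Real.exp (s * l₂) - β) : m * (α⁻¹ + β⁻¹) ≤ l₁ + l₂ := by
  have hβ : 0 < β := hα.trans_le hαβ
  set p := s * m / α with hp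
  set q := s * m / β with hq
  have hp0 : 0 ≤ p := by positivity
  have hq0 : 0 ≤ q := by positivity
  have hqp : q ≤ p := by
    rw [hp, hq]
    gcongr
  have h1 : Real.exp (-(s * l₁)) ≤ 1 - p := by
    rw [hp, le_sub_comm, div_le_iff₀ hα]
    linarith
  have h2 : 1 + q ≤ Real.exp (s * l₂) := by
    rw [hq, ← le_sub_iff_add_le', div_le_iff₀ hβ]
    linarith
  have hp1 : 0 < 1 - p := (Real.exp_pos _).trans_le h1
  have hl1 := Real.log_le_log (Real.exp_pos _) h1
  have hl2 := Real.log_le_log (by positivity) h2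
  rw [Real.log_exp] at hl1 hl2
  have hz := Real.le_log_one_add_of_nonneg (x := (p + q) / (1 - p)) (by positivity)
  have e1 : 1 + (p + q) / (1 - p) = (1 + q) / (1 - p) := by
    field_simp
    ring
  rw [e1, Real.log_div (by positivity) hp1.ne'] at hz
  have e2 : p + q ≤ 2 * ((p + q) / (1 - p)) / ((p + q) / (1 - p) + 2) := by
    have : 2 * ((p + q) / (1 - p)) / ((p + q) / (1 - p) + 2) = 2 * (p + q) / (2 - p + q) := by
      have : 2 - p + q ≠ 0 := by linarith
      have h3 : p + q + (1 - p) * 2 ≠ 0 := by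
        intro h
        apply this
        linarith
      field_simp
      ring
    rw [this, le_div_iff₀ (by linarith)]
    nlinarith [mul_nonneg (add_nonneg hp0 hq0) (sub_nonneg.2 hqp)]
  have e3 : p + q = s * (m * (α⁻¹ + β⁻¹)) := by
    rw [hp, hq]
    ring
  refine le_of_mul_le_mul_left ?_ hs
  rw [← e3]
  linarith

lemma log_div_le {α β : ℝ} (hα : 0 < α) (hαβ : α ≤ β) :
    Real.log β - Real.log α ≤ (β - α) * (α⁻¹ + β⁻¹) / 2 := by
  have hβ := hα.trans_le hαβ
  have h1 : 1 ≤ β / α := (one_le_div hα).2 hαβ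
  have := Real.self_le_sinh_iff.2 (Real.log_nonneg h1)
  rw [Real.sinh_log (by positivity), Real.log_div hβ.ne' hα.ne'] at this
  refine this.trans (le_of_eq ?_)
  field_simp
  ring

lemma two_mul_mul_le_of_exp {α β s m k l₁ l₂ D : ℝ} (hα : 0 < α) (hs : 0 < s) (hm : 0 ≤ m)
    (hk : 0 ≤ k) (hD : 0 < D) (hsD : s * D = Real.log β - Real.log α) (hβ : 0 < β)
    (h₁ : s * m ≤ α - α * Real.exp (-(s * l₁)))
    (h₂ : s * m ≤ β * Real.exp (s * l₂) - β) (h₃ : β - α ≤ s * k) :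
    2 * m * D ≤ k * (l₁ + l₂) := by
  have hαβ : α ≤ β := by
    rw [← Real.log_le_log_iff hα hβ]
    nlinarith [mul_pos hs hD]
  have hA := inv_add_inv_mul_le hα hs hm hαβ h₁ h₂
  have hB := log_div_le hα hαβ
  have hpos : 0 < α⁻¹ + β⁻¹ := by positivity
  have hD' : 2 * D ≤ k * (α⁻¹ + β⁻¹) := by
    refine le_of_mul_le_mul_left ?_ hs
    nlinarith
  nlinarith [mul_le_mul_of_nonneg_left hA hk, mul_le_mul_of_nonneg_left hD' hm]

lemma mass_length_le {f : ℝ → ℝ} (hf0 : ∀ x, 0 ≤ f x)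
    (hf : ∀ x y : ℝ, ∀ t ∈ Icc (0 : ℝ) 1, f x ^ (1 - t) * f y ^ t ≤ f ((1 - t) * x + t * y))
    (hint : Integrable f) {x c d y m k : ℝ} (hxc : x ≤ c) (hcd : c < d) (hdy : d ≤ y)
    (hc : 0 < f c) (hd : 0 < f d) (h₁ : ∫ t in x..c, f t = m) (h₂ : ∫ t in d..y, f t = m)
    (h₃ : ∫ t in c..d, f t = k) :
    2 * m * (d - c) ≤ k * ((c - x) + (y - d)) := by
  have hcd' := sub_pos.2 hcd
  obtain ⟨s, hs⟩ : ∃ s, s * (d - c) = Real.log (f d) - Real.log (f c) :=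
    ⟨(Real.log (f d) - Real.log (f c)) / (d - c), by field_simp⟩
  have hm : 0 ≤ m := h₁ ▸ intervalIntegral.integral_nonneg hxc fun t _ => hf0 t
  have hk : 0 ≤ k := h₃ ▸ intervalIntegral.integral_nonneg hcd.le fun t _ => hf0 t
  have hi : ∀ a b, IntervalIntegrable (fun t => f c * Real.exp (s * (t - c))) volume a b :=
    fun a b => Continuous.intervalIntegrable (by fun_prop) _ _
  have i₁ : m ≤ ∫ t in x..c, f c * Real.exp (s * (t - c)) := h₁ ▸
    intervalIntegral.integral_mono_on hxc hint.intervalIntegrable (hi _ _)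
      fun t ht => le_exp_of_log_concave hf0 hf hcd hc hd hs (Or.inl ht.2)
  have i₂ : m ≤ ∫ t in d..y, f c * Real.exp (s * (t - c)) := h₂ ▸
    intervalIntegral.integral_mono_on hdy hint.intervalIntegrable (hi _ _)
      fun t ht => le_exp_of_log_concave hf0 hf hcd hc hd hs (Or.inr ht.1)
  have i₃ : ∫ t in c..d, f c * Real.exp (s * (t - c)) ≤ k := h₃ ▸
    intervalIntegral.integral_mono_on hcd.le (hi _ _) hint.intervalIntegrable
      fun t ht => exp_le_of_log_concave hf hcd hc hd hs ht
  have e₁ := mul_integral_exp (f c) s c x c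
  have e₂ := mul_integral_exp (f c) s c d y
  have e₃ := mul_integral_exp (f c) s c c d
  have hfd : f c * Real.exp (s * (d - c)) = f d := by
    rw [hs, Real.exp_sub, Real.exp_log hc, Real.exp_log hd]
    field_simp
  have hfy : f c * Real.exp (s * (y - c)) = f d * Real.exp (s * (y - d)) := by
    rw [← hfd, mul_assoc, ← Real.exp_add]
    ring_nf
  rw [hfd] at e₂ e₃
  rw [hfy] at e₂
  simp only [sub_self, mul_zero, Real.exp_zero, mul_one] at e₁ e₃
  rcases lt_trichotomy s 0 with hneg | rfl | hpos
  · have := two_mul_mul_le_of_exp (s := -s) (m := m) (k := k) (l₁ := y - d) (l₂ := c - x) hd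
      (neg_pos.2 hneg) hm hk hcd' (by linarith) hc
      (by simp only [neg_mul, neg_neg]; nlinarith)
      (by
        have : -s * (c - x) = s * (x - c) := by ring
        rw [this]
        nlinarith) (by nlinarith)
    linarith
  · simp only [zero_mul, Real.exp_zero, mul_one, intervalIntegral.integral_const,
      smul_eq_mul] at i₁ i₂ i₃
    nlinarith [mul_le_mul_of_nonneg_left i₃ hm, mul_le_mul_of_nonneg_left i₁ hk,
      mul_le_mul_of_nonneg_left i₂ hk, mul_le_mul_of_nonneg_left i₁ hcd'.le,
      mul_le_mul_of_nonneg_right i₃ (add_nonneg (sub_nonneg.2 hxc) (sub_nonneg.2 hdy)),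
      mul_le_mul_of_nonneg_right i₁ hcd'.le, mul_le_mul_of_nonneg_right i₂ hcd'.le]
  · refine two_mul_mul_le_of_exp hc hpos hm hk hcd' hs hd ?_ ?_ ?_
    · have : -(s * (c - x)) = s * (x - c) := by ring
      rw [this]
      nlinarith
    · nlinarith
    · nlinarith

lemma integrableOn_Ioi_sq_mul {f : ℝ → ℝ} (hf0 : ∀ x, 0 ≤ f x)
    (hf : ∀ x y : ℝ, ∀ t ∈ Icc (0 : ℝ) 1, f x ^ (1 - t) * f y ^ t ≤ f ((1 - t) * x + t * y))
    (hint : Integrable f) {c : ℝ} (hc : 0 < f c) :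
    IntegrableOn (fun x => x ^ 2 * f x) (Ioi c) := by
  obtain ⟨d, hd, hfd⟩ : ∃ d, max c 0 < d ∧ f d < f c := by
    by_contra! hall
    have h : IntegrableOn (fun _ => f c) (Ioi (max c 0)) := by
      refine Integrable.mono' (g := f) hint.integrableOn aestronglyMeasurable_const ?_
      filter_upwards [ae_restrict_mem measurableSet_Ioi] with x hx
      rw [Real.norm_of_nonneg hc.le]
      exact hall x hx
    rw [integrableOn_const_iff] at h
    simp [hc.ne'] at h
  obtain ⟨hcd, hd0⟩ := max_lt_iff.1 hd
  obtain ⟨C, b, hC, hb, hbound⟩ : ∃ C b : ℝ, 0 ≤ C ∧ 0 < b ∧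
      ∀ t, d < t → f t ≤ C * Real.exp (-b * t) := by
    rcases (hf0 d).eq_or_lt with h0 | h0
    · refine ⟨0, 1, le_rfl, one_pos, fun t ht => ?_⟩
      rw [zero_mul]
      by_contra! hpos
      exact absurd h0 (log_three_point hf hcd.le ht.le (hcd.trans ht) hc hpos).1.ne
    · have hcd' := sub_pos.2 hcd
      set s := (Real.log (f d) - Real.log (f c)) / (d - c) with hs
      have hs' : s * (d - c) = Real.log (f d) - Real.log (f c) := by
        rw [hs]
        field_simp
      have hsneg : s < 0 := div_neg_of_neg_of_pos (sub_neg.2 (Real.log_lt_log h0 hfd)) hcd'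
      refine ⟨f c * Real.exp (-s * c), -s, by positivity, neg_pos.2 hsneg, fun t ht => ?_⟩
      refine (le_exp_of_log_concave hf0 hf hcd hc h0 hs' (Or.inr ht.le)).trans (le_of_eq ?_)
      rw [mul_assoc, ← Real.exp_add]
      ring_nf
  have hmeas : Measurable f := measurable_of_log_concave hf0 hf
  rw [← Ioc_union_Ioi_eq_Ioi hcd.le]
  refine IntegrableOn.union ?_ ?_
  · exact (IntegrableOn.continuousOn_mul (by fun_prop) hint.integrableOn
      isCompact_Icc).mono_set Ioc_subset_Icc_self
  · refine Integrable.mono' (g := fun t => 8 * C / b ^ 2 * Real.exp (-(b / 2) * t))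
      ((exp_neg_integrableOn_Ioi d (half_pos hb)).const_mul _)
      ((measurable_id.pow_const 2).mul hmeas).aestronglyMeasurable ?_
    filter_upwards [ae_restrict_mem measurableSet_Ioi] with t ht
    have ht0 : 0 ≤ t := hd0.le.trans (le_of_lt ht)
    rw [Real.norm_of_nonneg (mul_nonneg (sq_nonneg _) (hf0 t))]
    have h2 := Real.pow_div_factorial_le_exp (b / 2 * t) (by positivity) 2
    have h3 : t ^ 2 ≤ 8 / b ^ 2 * Real.exp (b / 2 * t) := by
      rw [div_mul_eq_mul_div, le_div_iff₀ (by positivity)]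
      norm_num [Nat.factorial] at h2
      linarith
    calc t ^ 2 * f t ≤ (8 / b ^ 2 * Real.exp (b / 2 * t)) * (C * Real.exp (-b * t)) := by
          exact mul_le_mul h3 (hbound t ht) (hf0 t) (by positivity)
      _ = 8 * C / b ^ 2 * (Real.exp (b / 2 * t) * Real.exp (-b * t)) := by ring
      _ = _ := by
          rw [← Real.exp_add]
          ring_nf

lemma integrable_sq_mul {f : ℝ → ℝ} (hf0 : ∀ x, 0 ≤ f x)
    (hf : ∀ x y : ℝ, ∀ t ∈ Icc (0 : ℝ) 1, f x ^ (1 - t) * f y ^ t ≤ f ((1 - t) * x + t * y))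
    (hint : Integrable f) : Integrable (fun x => x ^ 2 * f x) := by
  by_cases h : ∃ c, 0 < f c
  · obtain ⟨c, hc⟩ := h
    have h1 := integrableOn_Ioi_sq_mul hf0 hf hint hc
    have h2 := integrableOn_Ioi_sq_mul (f := fun x => f (-x)) (c := -c) (fun x => hf0 (-x))
      (fun x y t ht => by
        have := hf (-x) (-y) t ht
        rwa [show (1 - t) * -x + t * -y = -((1 - t) * x + t * y) by ring] at this)
      hint.comp_neg (by simpa using hc)
    have h3 : IntegrableOn (fun x => x ^ 2 * f x) (Iio c) := by
      rw [← integrable_indicator_iff measurableSet_Ioi] at h2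
      rw [← integrable_indicator_iff measurableSet_Iio]
      refine h2.comp_neg.congr (Eventually.of_forall fun x => ?_)
      simp [indicator_apply]
    have h4 : IntegrableOn (fun x => x ^ 2 * f x) (Iic c) := by
      rwa [integrableOn_Iic_iff_integrableOn_Iio]
    rw [← integrableOn_univ, ← Iic_union_Ioi (a := c)]
    exact h4.union h1
  · push Not at h
    have : f = 0 := funext fun x => le_antisymm (h x) (hf0 x)
    simp [this]

lemma integrable_of_withDensity {f : ℝ → ℝ} (hf0 : ∀ x, 0 ≤ f x) (hm : Measurable f)
    [IsProbabilityMeasure (volume.withDensity fun x => ENNReal.ofReal (f x))] :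
    Integrable f := by
  have h1 : (volume.withDensity fun x => ENNReal.ofReal (f x)) univ = 1 := measure_univ
  rw [withDensity_apply _ MeasurableSet.univ, Measure.restrict_univ] at h1
  refine ⟨hm.aestronglyMeasurable, ?_⟩
  rw [hasFiniteIntegral_iff_ofReal (Eventually.of_forall hf0), h1]
  exact ENNReal.one_lt_top

lemma measureReal_withDensity_Iic {f : ℝ → ℝ} (hf0 : ∀ x, 0 ≤ f x) (hint : Integrable f) (a : ℝ) :
    (volume.withDensity fun x => ENNReal.ofReal (f x)).real (Iic a) = ∫ x in Iic a, f x := by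
  rw [Measure.real, withDensity_apply _ measurableSet_Iic,
    ← ofReal_integral_eq_lintegral_ofReal hint.integrableOn (Eventually.of_forall hf0),
    ENNReal.toReal_ofReal (integral_nonneg hf0)]

lemma Flc.integrable_sq {ν : Measure ℝ} (hν : ν ∈ Flc) : Integrable (fun x => x ^ 2) ν := by
  obtain ⟨hprob, ⟨x, rfl⟩ | ⟨f, hf0, rfl, hf⟩⟩ := hν
  · exact integrable_dirac (by simp)
  · have hm := measurable_of_log_concave hf0 hf
    have hint := integrable_of_withDensity hf0 hm
    rw [integrable_withDensity_iff hm.ennreal_ofReal (by simp)]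
    simpa only [ENNReal.toReal_ofReal (hf0 _)] using integrable_sq_mul hf0 hf hint

lemma Flc.memLp_quantile {ν : Measure ℝ} (hν : ν ∈ Flc) :
    MemLp (quantile ν) 2 (volume.restrict (Ioo 0 1)) := by
  have := hν.1
  rw [memLp_two_iff_integrable_sq (aemeasurable_quantile ν).aestronglyMeasurable]
  have h := Flc.integrable_sq hν
  rw [← map_quantile ν] at h
  exact h.comp_aemeasurable (aemeasurable_quantile ν)

lemma pos_quantile {f : ℝ → ℝ}
    (hf : ∀ x y : ℝ, ∀ t ∈ Icc (0 : ℝ) 1, f x ^ (1 - t) * f y ^ t ≤ f ((1 - t) * x + t * y))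
    [IsProbabilityMeasure (volume.withDensity fun x => ENNReal.ofReal (f x))] {u : ℝ}
    (hu : u ∈ Ioo (0 : ℝ) 1) :
    0 < f (quantile (volume.withDensity fun x => ENNReal.ofReal (f x)) u) := by
  set ν := volume.withDensity fun x => ENNReal.ofReal (f x) with hν
  have hq : ν.real (Iic (quantile ν u)) = u := measureReal_Iic_quantile hu
  set q := quantile ν u
  have hpos : ∀ s : Set ℝ, MeasurableSet s → 0 < ν.real s → ∃ a ∈ s, 0 < f a := by
    intro s hs h
    by_contra! hall
    refine h.ne' ?_
    rw [Measure.real, hν, withDensity_apply _ hs, setLIntegral_congr_fun hs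
      (g := fun _ => 0) fun x hx => ENNReal.ofReal_of_nonpos (hall x hx)]
    simp
  obtain ⟨a, ha, hfa⟩ := hpos _ measurableSet_Iic (by rw [hq]; exact hu.1)
  obtain ⟨b, hb, hfb⟩ := hpos (Ioi q) measurableSet_Ioi (by
    rw [← compl_Iic, probReal_compl_eq_one_sub measurableSet_Iic, hq]
    linarith [hu.2])
  exact (log_three_point hf ha (le_of_lt hb) (lt_of_le_of_lt ha hb) hfa hfb).1

lemma quantile_dirac (x : ℝ) {u : ℝ} (hu : u ∈ Ioo (0 : ℝ) 1) :
    quantile (Measure.dirac x) u = x := by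
  refine eq_of_forall_ge_iff fun y => ?_
  rw [quantile_le_iff hu, Measure.real, Measure.dirac_apply' _ measurableSet_Iic]
  by_cases h : x ≤ y <;> simp [h, hu.1, hu.2.le]

lemma Flc.quantile_spread_le {ν : Measure ℝ} (hν : ν ∈ Flc) {v w : ℝ} (hv : 0 < v) (hvw : v < w)
    (hw : w < 1 / 2) :
    w * (quantile ν (1 / 2 + v) - quantile ν (1 / 2 - v)) ≤
      v * (quantile ν (1 / 2 + w) - quantile ν (1 / 2 - w)) := by
  have hx : 1 / 2 - w ∈ Ioo (0 : ℝ) 1 := ⟨by linarith, by linarith⟩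
  have hc : 1 / 2 - v ∈ Ioo (0 : ℝ) 1 := ⟨by linarith, by linarith⟩
  have hd : 1 / 2 + v ∈ Ioo (0 : ℝ) 1 := ⟨by linarith, by linarith⟩
  have hy : 1 / 2 + w ∈ Ioo (0 : ℝ) 1 := ⟨by linarith, by linarith⟩
  obtain ⟨hprob, ⟨x, rfl⟩ | ⟨f, hf0, rfl, hf⟩⟩ := hν
  · rw [quantile_dirac x hx, quantile_dirac x hc, quantile_dirac x hd, quantile_dirac x hy]
    simp
  have hint := integrable_of_withDensity hf0 (measurable_of_log_concave hf0 hf)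
  have hpc := pos_quantile hf hc
  have hpd := pos_quantile hf hd
  have hF := measureReal_withDensity_Iic hf0 hint
  set ν := volume.withDensity fun x => ENNReal.ofReal (f x) with hν
  have hmono := quantile_monotoneOn ν
  have hdiff : ∀ p ∈ Ioo (0 : ℝ) 1, ∀ q ∈ Ioo (0 : ℝ) 1,
      ∫ t in quantile ν p..quantile ν q, f t = q - p := fun p hp q hq => by
    rw [← intervalIntegral.integral_Iic_sub_Iic hint.integrableOn hint.integrableOn, ← hF, ← hF,
      measureReal_Iic_quantile hq, measureReal_Iic_quantile hp]
  have hlt : quantile ν (1 / 2 - v) < quantile ν (1 / 2 + v) := by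
    refine lt_of_le_of_ne (hmono hc hd (by linarith)) fun h => ?_
    have := hdiff _ hc _ hd
    rw [h, intervalIntegral.integral_same] at this
    linarith
  have key := mass_length_le (m := w - v) (k := 2 * v) hf0 hf hint
    (hmono hx hc (by linarith)) hlt (hmono hd hy (by linarith)) hpc hpd
    (by rw [hdiff _ hx _ hc]; ring) (by rw [hdiff _ hd _ hy]; ring) (by rw [hdiff _ hc _ hd]; ring)
  linarith

/-- The quantile function of the measure `(1/2) δ_{-1} + (1/2) δ_1`. -/
noncomputable def twoPointQuantile (u : ℝ) : ℝ := if u ≤ 1 / 2 then -1 else 1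

lemma isProbabilityMeasure_twoPoint :
    IsProbabilityMeasure ((1 / 2 : ENNReal) • Measure.dirac (-1 : ℝ) +
      (1 / 2 : ENNReal) • Measure.dirac 1) :=
  ⟨by simp [ENNReal.inv_two_add_inv_two]⟩

lemma quantile_twoPoint {u : ℝ} (hu : u ∈ Ioo (0 : ℝ) 1) :
    quantile ((1 / 2 : ENNReal) • Measure.dirac (-1 : ℝ) +
      (1 / 2 : ENNReal) • Measure.dirac 1) u = twoPointQuantile u := by
  have := isProbabilityMeasure_twoPoint
  obtain ⟨h0, h1⟩ := hu
  refine eq_of_forall_ge_iff fun y => ?_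
  rw [quantile_le_iff ⟨h0, h1⟩, Measure.real, Measure.add_apply, Measure.smul_apply,
    Measure.smul_apply, Measure.dirac_apply' _ measurableSet_Iic,
    Measure.dirac_apply' _ measurableSet_Iic, twoPointQuantile]
  rcases lt_or_ge y (-1) with hy | hy
  · have hy' : y < 1 := by linarith
    have : ¬ u ≤ 0 := not_le.2 h0
    split_ifs <;> simp [hy, hy', this]
  rcases lt_or_ge y 1 with hy' | hy'
  · split_ifs with h
    · simpa [hy, hy'] using h
    · simpa [hy, hy', hy'.not_ge] using h
  · split_ifs with h <;> simp [hy, hy', ENNReal.inv_two_add_inv_two, h1.le]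

lemma Flc.unif_mem :
    (ENNReal.ofReal 3)⁻¹ • volume.restrict (Icc (-(3 / 2) : ℝ) (3 / 2)) ∈ Flc := by
  refine ⟨⟨?_⟩, Or.inr ⟨(Icc (-(3 / 2) : ℝ) (3 / 2)).indicator fun _ => 1 / 3, ?_, ?_, ?_⟩⟩
  · rw [Measure.smul_apply, Measure.restrict_apply_univ, Real.volume_Icc, smul_eq_mul]
    norm_num
    exact ENNReal.inv_mul_cancel (by norm_num) (by norm_num)
  · exact fun x => indicator_nonneg (fun _ _ => by norm_num) x
  · have : (fun x => ENNReal.ofReal ((Icc (-(3 / 2) : ℝ) (3 / 2)).indicator (fun _ => 1 / 3) x)) =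
        (Icc (-(3 / 2) : ℝ) (3 / 2)).indicator fun _ => (ENNReal.ofReal 3)⁻¹ := by
      ext x
      by_cases hx : x ∈ Icc (-(3 / 2) : ℝ) (3 / 2)
      · rw [indicator_of_mem hx, indicator_of_mem hx, one_div,
          ENNReal.ofReal_inv_of_pos (by norm_num)]
      · rw [indicator_of_notMem hx, indicator_of_notMem hx, ENNReal.ofReal_zero]
    rw [this, withDensity_indicator measurableSet_Icc, withDensity_const]
  · intro x y t ht
    have hnn : ∀ z, 0 ≤ (Icc (-(3 / 2) : ℝ) (3 / 2)).indicator (fun _ => (1 / 3 : ℝ)) z :=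
      fun z => indicator_nonneg (fun _ _ => by norm_num) z
    rcases ht.1.eq_or_lt with rfl | h0
    · simp
    rcases ht.2.eq_or_lt with rfl | h1
    · simp
    by_cases hx : x ∈ Icc (-(3 / 2) : ℝ) (3 / 2)
    · by_cases hy : y ∈ Icc (-(3 / 2) : ℝ) (3 / 2)
      · have hmem := (convex_Icc (-(3 / 2) : ℝ) (3 / 2)) hx hy (sub_nonneg.2 ht.2) ht.1
          (sub_add_cancel 1 t)
        simp only [smul_eq_mul] at hmem
        rw [indicator_of_mem hx, indicator_of_mem hy, indicator_of_mem hmem,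
          ← Real.rpow_add (by norm_num), sub_add_cancel, Real.rpow_one]
      · rw [indicator_of_notMem hy, Real.zero_rpow h0.ne', mul_zero]
        exact hnn _
    · rw [indicator_of_notMem hx, Real.zero_rpow (sub_pos.2 h1).ne', zero_mul]
      exact hnn _

lemma quantile_unif {u : ℝ} (hu : u ∈ Ioo (0 : ℝ) 1) :
    quantile ((ENNReal.ofReal 3)⁻¹ • volume.restrict (Icc (-(3 / 2) : ℝ) (3 / 2))) u =
      3 * u - 3 / 2 := by
  have := Flc.unif_mem.1
  refine eq_of_forall_ge_iff fun y => ?_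
  have hset : Iic y ∩ Icc (-(3 / 2) : ℝ) (3 / 2) = Icc (-(3 / 2)) (min y (3 / 2)) := by
    ext z
    simp only [mem_inter_iff, mem_Iic, mem_Icc, le_min_iff]
    tauto
  rw [quantile_le_iff hu, Measure.real, Measure.smul_apply, Measure.restrict_apply measurableSet_Iic,
    hset, Real.volume_Icc, smul_eq_mul, ENNReal.toReal_mul, ENNReal.toReal_inv,
    ENNReal.toReal_ofReal (by norm_num), ENNReal.toReal_ofReal']
  obtain ⟨h0, h1⟩ := hu
  rcases le_total y (3 / 2) with h | h
  · rw [min_eq_left h]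
    rcases le_total (y - -(3 / 2)) 0 with h' | h'
    · rw [max_eq_right h']
      constructor <;> intro <;> linarith
    · rw [max_eq_left h']
      constructor <;> intro <;> linarith
  · rw [min_eq_right h]
    norm_num
    constructor <;> intro <;> linarith

lemma integral_abs_sub_sq :
    ∫ u in (0 : ℝ)..1, (|u - 1 / 2| - 3 * (u - 1 / 2) ^ 2) = 0 := by
  have hcont : Continuous fun u : ℝ => |u - 1 / 2| - 3 * (u - 1 / 2) ^ 2 := by fun_prop
  rw [← intervalIntegral.integral_add_adjacent_intervals (hcont.intervalIntegrable 0 (1 / 2))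
    (hcont.intervalIntegrable (1 / 2) 1)]
  have h1 : ∫ u in (0 : ℝ)..(1 / 2), (|u - 1 / 2| - 3 * (u - 1 / 2) ^ 2) =
      ∫ u in (0 : ℝ)..(1 / 2), (-1 / 4 + 2 * u - 3 * u ^ 2) := by
    refine intervalIntegral.integral_congr fun u hu => ?_
    rw [uIcc_of_le (by norm_num)] at hu
    rw [abs_of_nonpos (by linarith [hu.2])]
    ring
  have h2 : ∫ u in (1 / 2 : ℝ)..1, (|u - 1 / 2| - 3 * (u - 1 / 2) ^ 2) =
      ∫ u in (1 / 2 : ℝ)..1, (-5 / 4 + 4 * u - 3 * u ^ 2) := by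
    refine intervalIntegral.integral_congr fun u hu => ?_
    rw [uIcc_of_le (by norm_num)] at hu
    rw [abs_of_nonneg (by linarith [hu.1])]
    ring
  rw [h1, h2]
  rw [intervalIntegral.integral_sub (Continuous.intervalIntegrable (by fun_prop) _ _)
      (Continuous.intervalIntegrable (by fun_prop) _ _),
    intervalIntegral.integral_add (Continuous.intervalIntegrable (by fun_prop) _ _)
      (Continuous.intervalIntegrable (by fun_prop) _ _),
    intervalIntegral.integral_sub (Continuous.intervalIntegrable (by fun_prop) _ _)
      (Continuous.intervalIntegrable (by fun_prop) _ _),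
    intervalIntegral.integral_add (Continuous.intervalIntegrable (by fun_prop) _ _)
      (Continuous.intervalIntegrable (by fun_prop) _ _)]
  have h3 : ∀ r a b : ℝ, ∫ u in a..b, r * u = r * ((b ^ 2 - a ^ 2) / 2) := fun r a b => by
    rw [intervalIntegral.integral_const_mul, integral_id]
  simp only [h3, intervalIntegral.integral_const_mul, integral_pow,
    intervalIntegral.integral_const, smul_eq_mul]
  norm_num

lemma twoPointQuantile_sub_mul (u : ℝ) :
    (twoPointQuantile u - (3 * u - 3 / 2)) * (u - 1 / 2) =
      |u - 1 / 2| - 3 * (u - 1 / 2) ^ 2 := by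
  rw [twoPointQuantile]
  split_ifs with h
  · rw [abs_of_nonpos (by linarith)]
    ring
  · rw [abs_of_nonneg (by linarith)]
    ring

lemma memLp_twoPointQuantile : MemLp twoPointQuantile 2 (volume.restrict (Ioo 0 1)) := by
  refine MemLp.of_bound (C := 1) (Measurable.ite measurableSet_Iic measurable_const
    measurable_const).aestronglyMeasurable (Eventually.of_forall fun u => ?_)
  rw [twoPointQuantile]
  split_ifs <;> simp

lemma memLp_affine : MemLp (fun u : ℝ => 3 * u - 3 / 2) 2 (volume.restrict (Ioo 0 1)) := by
  refine MemLp.of_bound (C := 3 / 2) (by fun_prop) ?_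
  filter_upwards [ae_restrict_mem measurableSet_Ioo] with u hu
  rw [Real.norm_eq_abs, abs_le]
  constructor <;> linarith [hu.1, hu.2]

lemma integral_residual_mul_le {Q : ℝ → ℝ} (hQ : MemLp Q 2 (volume.restrict (Ioo 0 1)))
    (hspread : ∀ v w : ℝ, 0 < v → v < w → w < 1 / 2 →
      w * (Q (1 / 2 + v) - Q (1 / 2 - v)) ≤ v * (Q (1 / 2 + w) - Q (1 / 2 - w))) :
    ∫ u in Ioo (0 : ℝ) 1, (twoPointQuantile u - (3 * u - 3 / 2)) * Q u ≤ 0 := by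
  have hint : Integrable (fun u => (twoPointQuantile u - (3 * u - 3 / 2)) * Q u)
      (volume.restrict (Ioo 0 1)) := (memLp_twoPointQuantile.sub memLp_affine).integrable_mul hQ
  set φ : ℝ → ℝ := fun u => (twoPointQuantile u - (3 * u - 3 / 2)) * Q u with hφ
  have hi : IntervalIntegrable φ volume 0 1 := by
    rw [intervalIntegrable_iff_integrableOn_Ioo_of_le zero_le_one]
    exact hint
  have hi' : IntervalIntegrable (fun u => φ (1 - u)) volume 0 1 := by
    simpa using (hi.comp_sub_left 1).symm
  have hsymm : ∫ u in (0 : ℝ)..1, φ (1 - u) = ∫ u in (0 : ℝ)..1, φ u := by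
    simp [intervalIntegral.integral_comp_sub_left]
  set K := 3 * (Q (1 / 2 + 1 / 3) - Q (1 / 2 - 1 / 3)) with hK
  have hv : ∀ v : ℝ, 0 < v → v < 1 / 2 →
      (1 - 3 * v) * (Q (1 / 2 + v) - Q (1 / 2 - v)) ≤ K * (v - 3 * v ^ 2) := by
    intro v h0 h1
    rcases lt_trichotomy v (1 / 3) with h | rfl | h
    · have := hspread v (1 / 3) h0 h (by norm_num)
      have h3 : 0 ≤ 1 - 3 * v := by linarith
      nlinarith [mul_le_mul_of_nonneg_left this h3]
    · norm_num
    · have := hspread (1 / 3) v (by norm_num) h h1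
      have h3 : 0 ≤ 3 * v - 1 := by linarith
      nlinarith [mul_le_mul_of_nonneg_left this h3]
  have hle : ∫ u in (0 : ℝ)..1, (φ u + φ (1 - u)) ≤
      ∫ u in (0 : ℝ)..1, K * (|u - 1 / 2| - 3 * (u - 1 / 2) ^ 2) := by
    refine intervalIntegral.integral_mono_ae_restrict zero_le_one (hi.add hi')
      (Continuous.intervalIntegrable (by fun_prop) _ _) ?_
    rw [← Measure.restrict_congr_set (Ioo_ae_eq_Icc (a := (0 : ℝ)) (b := 1))]
    filter_upwards [ae_restrict_mem measurableSet_Ioo,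
      ae_restrict_of_ae (Measure.ae_ne volume (1 / 2 : ℝ))] with u hu hne
    simp only [hφ, twoPointQuantile]
    rcases lt_or_gt_of_ne hne with h | h
    · have := hv (1 / 2 - u) (by linarith) (by linarith [hu.1])
      rw [if_pos h.le, if_neg (by linarith), abs_of_neg (by linarith)]
      rw [show 1 / 2 + (1 / 2 - u) = 1 - u by ring, show 1 / 2 - (1 / 2 - u) = u by ring] at this
      linarith
    · have := hv (u - 1 / 2) (by linarith) (by linarith [hu.2])
      rw [if_neg (by linarith), if_pos (by linarith), abs_of_pos (by linarith)]
      rw [show 1 / 2 + (u - 1 / 2) = u by ring, show 1 / 2 - (u - 1 / 2) = 1 - u by ring] at this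
      linarith
  rw [intervalIntegral.integral_add hi hi', hsymm, intervalIntegral.integral_const_mul,
    integral_abs_sub_sq, mul_zero, intervalIntegral.integral_of_le zero_le_one,
    integral_Ioc_eq_integral_Ioo] at hle
  linarith

lemma integral_residual_mul_affine :
    ∫ u in Ioo (0 : ℝ) 1, (twoPointQuantile u - (3 * u - 3 / 2)) * (3 * u - 3 / 2) = 0 := by
  have : ∀ u : ℝ, (twoPointQuantile u - (3 * u - 3 / 2)) * (3 * u - 3 / 2) =
      3 * (|u - 1 / 2| - 3 * (u - 1 / 2) ^ 2) := fun u => by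
    rw [← twoPointQuantile_sub_mul]
    ring
  simp only [this]
  rw [← integral_Ioc_eq_integral_Ioo, ← intervalIntegral.integral_of_le zero_le_one,
    intervalIntegral.integral_const_mul, integral_abs_sub_sq, mul_zero]

lemma integral_sq_add_le {Q : ℝ → ℝ} (hQ : MemLp Q 2 (volume.restrict (Ioo 0 1)))
    (hspread : ∀ v w : ℝ, 0 < v → v < w → w < 1 / 2 →
      w * (Q (1 / 2 + v) - Q (1 / 2 - v)) ≤ v * (Q (1 / 2 + w) - Q (1 / 2 - w))) :
    (∫ u in Ioo (0 : ℝ) 1, (3 * u - 3 / 2 - twoPointQuantile u) ^ 2) +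
      ∫ u in Ioo (0 : ℝ) 1, (Q u - (3 * u - 3 / 2)) ^ 2 ≤
      ∫ u in Ioo (0 : ℝ) 1, (Q u - twoPointQuantile u) ^ 2 := by
  have hres := memLp_twoPointQuantile.sub memLp_affine
  have i₁ := (memLp_affine.sub memLp_twoPointQuantile).integrable_sq
  have i₂ := (hQ.sub memLp_affine).integrable_sq
  have i₃ : Integrable (fun u => (twoPointQuantile u - (3 * u - 3 / 2)) * Q u)
      (volume.restrict (Ioo 0 1)) := hres.integrable_mul hQ
  have i₄ : Integrable (fun u => (twoPointQuantile u - (3 * u - 3 / 2)) * (3 * u - 3 / 2))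
      (volume.restrict (Ioo 0 1)) := hres.integrable_mul memLp_affine
  simp only [Pi.sub_apply] at i₁ i₂
  have hexp : ∀ u, (Q u - twoPointQuantile u) ^ 2 =
      ((3 * u - 3 / 2 - twoPointQuantile u) ^ 2 + (Q u - (3 * u - 3 / 2)) ^ 2) -
        2 * ((twoPointQuantile u - (3 * u - 3 / 2)) * Q u -
          (twoPointQuantile u - (3 * u - 3 / 2)) * (3 * u - 3 / 2)) := fun u => by ring
  simp only [hexp]
  have i₁₂ : Integrable (fun u => (3 * u - 3 / 2 - twoPointQuantile u) ^ 2 +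
      (Q u - (3 * u - 3 / 2)) ^ 2) (volume.restrict (Ioo 0 1)) := i₁.add i₂
  have i₃₄ : Integrable (fun u => 2 * ((twoPointQuantile u - (3 * u - 3 / 2)) * Q u -
      (twoPointQuantile u - (3 * u - 3 / 2)) * (3 * u - 3 / 2)))
      (volume.restrict (Ioo 0 1)) := (i₃.sub i₄).const_mul 2
  rw [integral_sub i₁₂ i₃₄, integral_add i₁ i₂, integral_const_mul, integral_sub i₃ i₄, integral_residual_mul_affine]
  linarith [integral_residual_mul_le hQ hspread]

lemma Wdist_two_twoPoint (ν : Measure ℝ) :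
    Wdist 2 ν ((1 / 2 : ENNReal) • Measure.dirac (-1 : ℝ) +
      (1 / 2 : ENNReal) • Measure.dirac 1) =
      (∫ u in Ioo (0 : ℝ) 1, (quantile ν u - twoPointQuantile u) ^ 2) ^ (1 / 2 : ℝ) := by
  rw [Wdist]
  congr 1
  refine setIntegral_congr_fun measurableSet_Ioo fun u hu => ?_
  rw [quantile_twoPoint hu, Real.rpow_two, sq_abs]

lemma Wdist_two_unif_twoPoint :
    Wdist 2 ((ENNReal.ofReal 3)⁻¹ • volume.restrict (Icc (-(3 / 2) : ℝ) (3 / 2)))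
      ((1 / 2 : ENNReal) • Measure.dirac (-1 : ℝ) + (1 / 2 : ENNReal) • Measure.dirac 1) =
      (∫ u in Ioo (0 : ℝ) 1, (3 * u - 3 / 2 - twoPointQuantile u) ^ 2) ^ (1 / 2 : ℝ) := by
  rw [Wdist_two_twoPoint]
  congr 1
  refine setIntegral_congr_fun measurableSet_Ioo fun u hu => ?_
  rw [quantile_unif hu]

/-- Example 4.4. Let `μ = (1/2) δ_{−1} + (1/2) δ_1`. Then the uniform
distribution `Unif(−3/2, 3/2)` is the unique minimizer of `ν ↦ W_2(ν, μ)` over `F_lc`;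
that is, `proj_{F_lc} μ = Unif(−3/2, 3/2)`. -/
theorem wasserstein_projection_two_point_uniform :
    letI μ : MeasureTheory.Measure ℝ :=
      (1/2 : ENNReal) • MeasureTheory.Measure.dirac (-1) +
        (1/2 : ENNReal) • MeasureTheory.Measure.dirac 1
    letI unif : MeasureTheory.Measure ℝ :=
      (ENNReal.ofReal 3)⁻¹ • MeasureTheory.volume.restrict (Set.Icc (-(3/2) : ℝ) (3/2))
    unif ∈ Flc ∧
      (∀ ν ∈ Flc, Wdist 2 unif μ ≤ Wdist 2 ν μ) ∧
      (∀ ν ∈ Flc, (∀ ρ ∈ Flc, Wdist 2 ν μ ≤ Wdist 2 ρ μ) → ν = unif) := by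
  refine ⟨Flc.unif_mem, fun ν hν => ?_, fun ν hν hmin => ?_⟩
  · rw [Wdist_two_unif_twoPoint, Wdist_two_twoPoint]
    have hkey := integral_sq_add_le (Flc.memLp_quantile hν)
      fun v w h0 hvw hw => Flc.quantile_spread_le hν h0 hvw hw
    have hnn : 0 ≤ ∫ u in Ioo (0 : ℝ) 1, (quantile ν u - (3 * u - 3 / 2)) ^ 2 :=
      integral_nonneg fun _ => sq_nonneg _
    exact Real.rpow_le_rpow (integral_nonneg fun _ => sq_nonneg _) (by linarith) (by norm_num)
  · have hle := hmin _ Flc.unif_mem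
    rw [Wdist_two_unif_twoPoint, Wdist_two_twoPoint, Real.rpow_le_rpow_iff
      (integral_nonneg fun _ => sq_nonneg _) (integral_nonneg fun _ => sq_nonneg _)
      (by norm_num)] at hle
    have hkey := integral_sq_add_le (Flc.memLp_quantile hν)
      fun v w h0 hvw hw => Flc.quantile_spread_le hν h0 hvw hw
    have hnn : 0 ≤ ∫ u in Ioo (0 : ℝ) 1, (quantile ν u - (3 * u - 3 / 2)) ^ 2 :=
      integral_nonneg fun _ => sq_nonneg _
    have hzero : ∫ u in Ioo (0 : ℝ) 1, (quantile ν u - (3 * u - 3 / 2)) ^ 2 = 0 := by linarith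
    replace hzero := (integral_eq_zero_iff_of_nonneg (fun _ => sq_nonneg _)
      ((Flc.memLp_quantile hν).sub memLp_affine).integrable_sq).1 hzero
    have := hν.1
    have := Flc.unif_mem.1
    rw [← map_quantile ν, ← map_quantile ((ENNReal.ofReal 3)⁻¹ • volume.restrict _)]
    refine Measure.map_congr ?_
    filter_upwards [hzero, ae_restrict_mem measurableSet_Ioo] with u hu hmem
    rw [quantile_unif hmem]
    exact sub_eq_zero.1 (pow_eq_zero_iff two_ne_zero |>.1 hu)
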